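/- arXiv:2006.02010 — 7 statements merged into one kernel-verified Lean document; each statement's English description precedes it below -/
import Mathlib

section
/- Let α > 0, β > 0, and let h : ℝ → ℝ be continuous such that h(t) → 0 as |t| → ∞ and liminf_{|t|→∞} t·h(t) ≥ β, and set G(t) = ∫_0^t h(s)·exp(α s²) ds. Then the function t ↦ t·h(t)·exp(α t²) − 4·G(t) is bounded from below on ℝ, i.e., there exists a constant C such that t·h(t)·exp(α t²) − 4·G(t) ≥ −C for all t ∈ ℝ. -/
open MeasureTheory Filter

/-- A continuous function that is antitone on `(-∞, -R]` and monotone on `[R, ∞)` is bounded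
from below. -/
theorem Continuous.exists_forall_le_of_antitoneOn_of_monotoneOn {f : ℝ → ℝ} (hf : Continuous f)
    {R : ℝ} (hR : 0 ≤ R) (hanti : AntitoneOn f (Set.Iic (-R))) (hmono : MonotoneOn f (Set.Ici R)) :
    ∃ m, ∀ t, m ≤ f t := by
  obtain ⟨m, hm⟩ := (isCompact_Icc (a := -R) (b := R)).bddBelow_image hf.continuousOn
  have key : ∀ t ∈ Set.Icc (-R) R, m ≤ f t := fun t ht ↦ hm ⟨t, ht, rfl⟩
  refine ⟨m, fun t ↦ ?_⟩
  rcases le_total t (-R) with h1 | h1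
  · exact (key (-R) ⟨le_rfl, by linarith⟩).trans (hanti h1 Set.self_mem_Iic h1)
  rcases le_total t R with h2 | h2
  · exact key t ⟨h1, h2⟩
  · exact (key R ⟨by linarith, le_rfl⟩).trans (hmono Set.self_mem_Ici h2 h2)

/-- If `h` is continuous and vanishes at infinity, then every positive multiple of `e^{α t²}`
exceeds `∫_0^t h(s) e^{α s²} ds` up to an additive constant. -/
theorem exists_forall_le_mul_exp_sub_integral {α c : ℝ} (hα : 0 < α) (hc : 0 < c) {h : ℝ → ℝ}
    (hcont : Continuous h) (hlim : Tendsto h (cocompact ℝ) (nhds 0)) :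
    ∃ m : ℝ, ∀ t : ℝ,
      m ≤ c * Real.exp (α * t ^ 2) - ∫ s in (0:ℝ)..t, h s * Real.exp (α * s ^ 2) := by
  have hint : Continuous fun s ↦ h s * Real.exp (α * s ^ 2) := by fun_prop
  have hderiv : ∀ t : ℝ, HasDerivAt
      (fun t ↦ c * Real.exp (α * t ^ 2) - ∫ s in (0:ℝ)..t, h s * Real.exp (α * s ^ 2))
      ((2 * α * c * t - h t) * Real.exp (α * t ^ 2)) t := by
    intro t
    have h1 := ((((hasDerivAt_id t).pow 2).const_mul α).exp.const_mul c).sub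
      (hint.integral_hasStrictDerivAt 0 t).hasDerivAt
    refine h1.congr_deriv ?_
    simp
    ring
  have hdiff : Differentiable ℝ _ := fun t ↦ (hderiv t).differentiableAt
  have hsmall : ∀ᶠ t in cocompact ℝ, |h t| < 2 * α * c := by
    have := hlim.abs
    rw [abs_zero] at this
    exact this.eventually_lt_const (by positivity)
  obtain ⟨r, hr⟩ := (Metric.hasBasis_cobounded_compl_closedBall (0 : ℝ)).eventually_iff.1
    (Metric.cobounded_eq_cocompact (α := ℝ) ▸ hsmall) |>.imp fun _ ↦ And.right
  have hbound : ∀ t, max r 1 < |t| → |h t| < 2 * α * c := fun t ht ↦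
    hr (by simpa using (le_max_left r 1).trans_lt ht)
  have hac : 0 < 2 * α * c := by positivity
  have hr1 : 1 ≤ max r 1 := le_max_right r 1
  refine hdiff.continuous.exists_forall_le_of_antitoneOn_of_monotoneOn (R := max r 1)
    (by linarith) ?_ ?_
  · refine antitoneOn_of_deriv_nonpos (convex_Iic _) hdiff.continuous.continuousOn
      hdiff.differentiableOn fun t ht ↦ ?_
    rw [interior_Iic, Set.mem_Iio] at ht
    rw [(hderiv t).deriv]
    have hb := abs_lt.1 (hbound t (by rw [abs_of_neg] <;> linarith))
    exact mul_nonpos_of_nonpos_of_nonneg (by nlinarith) (Real.exp_pos _).le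
  · refine monotoneOn_of_deriv_nonneg (convex_Ici _) hdiff.continuous.continuousOn
      hdiff.differentiableOn fun t ht ↦ ?_
    rw [interior_Ici, Set.mem_Ioi] at ht
    rw [(hderiv t).deriv]
    have hb := abs_lt.1 (hbound t (by rw [abs_of_pos] <;> linarith))
    exact mul_nonneg (by nlinarith) (Real.exp_pos _).le

/-- If `α, β > 0`, `h` is continuous, `h(t) → 0` as `|t| → ∞`,
`liminf_{|t|→∞} t h(t) ≥ β`, and `G(t) = ∫_0^t h(s) e^{α s²} ds`, then
`t h(t) e^{α t²} - 4 G(t)` is bounded from below on `ℝ`. -/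
theorem stmt_3 (α β : ℝ) (hα : 0 < α) (hβ : 0 < β) (h : ℝ → ℝ) (hc : Continuous h)
    (hlim : Tendsto h (cocompact ℝ) (nhds 0))
    (hliminf : ∀ ε > 0, ∃ M > 0, ∀ t : ℝ, M < |t| → β - ε < t * h t) :
    ∃ C : ℝ, ∀ t : ℝ,
      -C ≤ t * h t * Real.exp (α * t ^ 2) - 4 * ∫ s in (0:ℝ)..t, h s * Real.exp (α * s ^ 2) := by
  obtain ⟨m, hm⟩ := exists_forall_le_mul_exp_sub_integral hα (c := β / 8) (by positivity) hc hlim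
  obtain ⟨M, -, hM⟩ := hliminf (β / 2) (by positivity)
  have hcont : Continuous fun t : ℝ ↦ (t * h t - β / 2) * Real.exp (α * t ^ 2) := by fun_prop
  obtain ⟨k, hk⟩ := (isCompact_Icc (a := -M) (b := M)).bddBelow_image hcont.continuousOn
  refine ⟨-(min k 0 + 4 * m), fun t ↦ ?_⟩
  have hfar : min k 0 ≤ (t * h t - β / 2) * Real.exp (α * t ^ 2) := by
    rcases le_or_gt |t| M with ht | ht
    · exact (min_le_left k 0).trans (hk ⟨t, abs_le.1 ht, rfl⟩)
    · exact (min_le_right k 0).trans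
        (mul_nonneg (by linarith [hM t ht]) (Real.exp_pos _).le)
  linarith [hm t]
end

section
/- Let α > 0, β > 0, and let h : ℝ → ℝ be continuous such that liminf_{|t|→∞} t·h(t) ≥ β, and set G(t) = ∫_0^t h(s)·exp(α s²) ds. Then for every ε with 0 < ε < β there exists a constant C > 0 such that G(t) ≥ (β − ε)·α²·t⁴/8 − C·|t| for all t ∈ ℝ. -/
open MeasureTheory

theorem integral_lower_bound_of_nonneg {f : ℝ → ℝ} (hf : Continuous f) {c C : ℝ}
    (hbound : ∀ s, 0 < s → c * s ^ 3 - C ≤ f s) {t : ℝ} (ht : 0 ≤ t) :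
    c * t ^ 4 / 4 - C * t ≤ ∫ s in (0:ℝ)..t, f s := by
  have hpoly : ∫ s in (0:ℝ)..t, (c * s ^ 3 - C) = c * t ^ 4 / 4 - C * t := by
    rw [intervalIntegral.integral_sub (Continuous.intervalIntegrable (by fun_prop) _ _)
      (Continuous.intervalIntegrable (by fun_prop) _ _),
      intervalIntegral.integral_const_mul, integral_pow, intervalIntegral.integral_const,
      smul_eq_mul]
    norm_num
    ring
  rw [← hpoly]
  exact intervalIntegral.integral_mono_on_of_le_Ioo ht
    (Continuous.intervalIntegrable (by fun_prop) _ _) (hf.intervalIntegrable _ _)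
    fun s hs => hbound s hs.1

theorem integral_lower_bound {f : ℝ → ℝ} (hf : Continuous f) {c C : ℝ}
    (hbound : ∀ s, c * s ^ 4 - C * |s| ≤ s * f s) (t : ℝ) :
    c * t ^ 4 / 4 - C * |t| ≤ ∫ s in (0:ℝ)..t, f s := by
  rcases le_total 0 t with ht | ht
  · rw [abs_of_nonneg ht]
    refine integral_lower_bound_of_nonneg hf (fun s hs => ?_) ht
    refine le_of_mul_le_mul_left ?_ hs
    have := hbound s
    rw [abs_of_pos hs] at this
    linarith
  · have key : c * (-t) ^ 4 / 4 - C * (-t) ≤ ∫ s in (0:ℝ)..(-t), -f (-s) := by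
      refine integral_lower_bound_of_nonneg (by fun_prop) (fun s hs => ?_) (neg_nonneg.2 ht)
      refine le_of_mul_le_mul_left ?_ hs
      have := hbound (-s)
      rw [abs_neg, abs_of_pos hs] at this
      linarith
    rw [intervalIntegral.integral_neg, intervalIntegral.integral_comp_neg, neg_neg, neg_zero,
      intervalIntegral.integral_symm 0 t, neg_neg] at key
    rw [abs_of_nonpos ht]
    linarith

/-- If `α, β > 0`, `h` is continuous with `liminf_{|t|→∞} t h(t) ≥ β`, and
`G(t) = ∫_0^t h(s) e^{α s²} ds`, then for every `0 < ε < β` there is `C > 0` with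
`G(t) ≥ (β - ε) α² t⁴ / 8 - C |t|` for all `t`. -/
theorem stmt_5 (α β : ℝ) (hα : 0 < α) (hβ : 0 < β) (h : ℝ → ℝ) (hc : Continuous h)
    (hliminf : ∀ ε > 0, ∃ M > 0, ∀ t : ℝ, M < |t| → β - ε < t * h t) :
    ∀ ε : ℝ, 0 < ε → ε < β → ∃ C > 0, ∀ t : ℝ,
      (β - ε) * α ^ 2 * t ^ 4 / 8 - C * |t| ≤ ∫ s in (0:ℝ)..t, h s * Real.exp (α * s ^ 2) := by
  intro ε hε hεβ
  obtain ⟨M, -, hM⟩ := hliminf ε hε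
  have hf : Continuous fun s => h s * Real.exp (α * s ^ 2) := by fun_prop
  obtain ⟨K, hK⟩ := (isCompact_Icc (a := -M) (b := M)).exists_bound_of_continuousOn
    (f := fun s => (β - ε) * α ^ 2 / 2 * s ^ 3 - h s * Real.exp (α * s ^ 2))
    (Continuous.continuousOn (by fun_prop))
  refine ⟨max K 1, by positivity, fun t => ?_⟩
  have key := integral_lower_bound hf (c := (β - ε) * α ^ 2 / 2) (C := max K 1) (fun s => ?_) t
  · linarith
  rcases le_or_gt |s| M with hs | hs
  · have hdiff := (hK s (abs_le.1 hs)).trans (le_max_left K 1)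
    have hmul := mul_le_mul_of_nonneg_left hdiff (abs_nonneg s)
    rw [Real.norm_eq_abs, ← abs_mul] at hmul
    have := (le_abs_self _).trans hmul
    linarith
  · have hexp := Real.quadratic_le_exp_of_nonneg (x := α * s ^ 2) (by positivity)
    have hsq : (α * s ^ 2) ^ 2 / 2 ≤ Real.exp (α * s ^ 2) := by
      have : 0 ≤ α * s ^ 2 := by positivity
      linarith
    have hC : 0 ≤ max K 1 * |s| := by positivity
    calc (β - ε) * α ^ 2 / 2 * s ^ 4 - max K 1 * |s|
        ≤ (β - ε) * ((α * s ^ 2) ^ 2 / 2) := by linarith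
      _ ≤ (s * h s) * Real.exp (α * s ^ 2) :=
          mul_le_mul (hM s hs).le hsq (by positivity) (by linarith [hM s hs])
      _ = s * (h s * Real.exp (α * s ^ 2)) := by ring
end

section
/- For every real d > 0, every integer j ≥ 2, and every γ with 0 ≤ γ < 2, the integral over ℝ² of ω_j(x)/‖x‖^γ with respect to Lebesgue measure equals (d^{2−γ}/(2−γ)²)·√(2π/log j)·(1 − 1/j^{2−γ}), where ω_j is the Moser function. -/
open MeasureTheory

/-- The Moser function on `ℝ²` associated with the radius `d` and the parameter `j`. -/
noncomputable def moser (d : ℝ) (j : ℕ) (x : EuclideanSpace ℝ (Fin 2)) : ℝ :=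
  if ‖x‖ ≤ d / j then Real.sqrt (Real.log j) / Real.sqrt (2 * Real.pi)
  else if ‖x‖ < d then Real.log (d / ‖x‖) / (Real.sqrt (2 * Real.pi) * Real.sqrt (Real.log j))
  else 0

open Set in
/-- Polar coordinates for radial functions on the Euclidean plane. -/
theorem integral_radial_plane (f : ℝ → ℝ) :
    ∫ x : EuclideanSpace ℝ (Fin 2), f ‖x‖ = 2 * Real.pi * ∫ r in Ioi (0 : ℝ), r * f r := by
  have hvol : (volume : Measure (EuclideanSpace ℝ (Fin 2))).real (Metric.ball 0 1) = Real.pi := by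
    simp [measureReal_def, EuclideanSpace.volume_ball_fin_two, Real.pi_pos.le]
  rw [integral_fun_norm_addHaar volume f, hvol]
  simp [mul_assoc]

/-- An antiderivative of `r ^ (a - 1) * log (d / r)` on the positive half-line. -/
theorem hasDerivAt_rpow_mul_log_div {a d r : ℝ} (ha : a ≠ 0) (hd : 0 < d) (hr : 0 < r) :
    HasDerivAt (fun r : ℝ => r ^ a * Real.log (d / r) / a + r ^ a / a ^ 2)
      (r ^ (a - 1) * Real.log (d / r)) r := by
  have hpow : HasDerivAt (fun r : ℝ => r ^ a) (a * r ^ (a - 1)) r :=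
    Real.hasDerivAt_rpow_const (Or.inl hr.ne')
  have hlog : HasDerivAt (fun r : ℝ => Real.log (d / r)) (-r⁻¹) r := by
    have h := (Real.hasDerivAt_log hr.ne').const_sub (Real.log d)
    refine h.congr_of_eventuallyEq ?_
    filter_upwards [lt_mem_nhds hr] with s hs
    exact Real.log_div hd.ne' hs.ne'
  refine (((hpow.mul hlog).div_const a).add (hpow.div_const (a ^ 2))).congr_deriv ?_
  rw [Real.rpow_sub_one hr.ne']
  field_simp
  ring

/-- The integral of `r ^ (a - 1) * log (d / r)` over `[c, d]`. -/
theorem integral_rpow_mul_log_div {a c d : ℝ} (ha : a ≠ 0) (hc : 0 < c) (hcd : c ≤ d) :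
    IntervalIntegrable (fun r : ℝ => r ^ (a - 1) * Real.log (d / r)) volume c d ∧
      ∫ r in c..d, r ^ (a - 1) * Real.log (d / r) =
        d ^ a / a ^ 2 - (c ^ a * Real.log (d / c) / a + c ^ a / a ^ 2) := by
  have hd : 0 < d := hc.trans_le hcd
  have hpos : ∀ r ∈ Set.uIcc c d, 0 < r := fun r hr => by
    rw [Set.uIcc_of_le hcd] at hr
    exact hc.trans_le hr.1
  have hint : IntervalIntegrable (fun r : ℝ => r ^ (a - 1) * Real.log (d / r)) volume c d := by
    refine ContinuousOn.intervalIntegrable fun r hr => ContinuousAt.continuousWithinAt ?_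
    have h := hpos r hr
    exact (Real.continuousAt_rpow_const r _ (Or.inl h.ne')).mul
      ((continuousAt_const.div continuousAt_id h.ne').log (div_pos hd h).ne')
  refine ⟨hint, ?_⟩
  rw [intervalIntegral.integral_eq_sub_of_hasDerivAt
    (fun r hr => hasDerivAt_rpow_mul_log_div ha hd (hpos r hr)) hint]
  simp [hd.ne']

/-- The integral over the half-line of `r ^ (a - 1)` against a profile equal to the constant `A`
on `(0, c]`, to `B * log (d / r)` on `(c, d)`, and to `0` beyond `d`. -/
theorem integral_rpow_mul_truncated_log {a c d : ℝ} (A B : ℝ) (ha : 0 < a) (hc : 0 < c)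
    (hcd : c ≤ d) :
    ∫ r in Set.Ioi (0 : ℝ), r ^ (a - 1) *
        (if r ≤ c then A else if r < d then B * Real.log (d / r) else 0) =
      A * (c ^ a / a) +
        B * (d ^ a / a ^ 2 - (c ^ a * Real.log (d / c) / a + c ^ a / a ^ 2)) := by
  set F : ℝ → ℝ := fun r => r ^ (a - 1) *
    (if r ≤ c then A else if r < d then B * Real.log (d / r) else 0) with hF
  have hd : 0 < d := hc.trans_le hcd
  obtain ⟨hint, hval⟩ := integral_rpow_mul_log_div ha.ne' hc hcd
  have hinner : Set.EqOn (fun r : ℝ => A * r ^ (a - 1)) F (Set.uIoc 0 c) := fun r hr => by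
    rw [Set.uIoc_of_le hc.le] at hr
    simp [hF, hr.2, mul_comm]
  have houter : Set.EqOn (fun r : ℝ => B * (r ^ (a - 1) * Real.log (d / r))) F
      (Set.uIoc c d) := fun r hr => by
    rw [Set.uIoc_of_le hcd] at hr
    rcases hr.2.lt_or_eq with h | rfl
    · simp only [hF, if_neg hr.1.not_ge, if_pos h]
      ring
    · simp [hF, hd.ne', hr.1.not_ge]
  have hint₁ : IntervalIntegrable F volume 0 c :=
    ((intervalIntegral.intervalIntegrable_rpow' (by linarith)).const_mul A).congr hinner
  have hint₂ : IntervalIntegrable F volume c d := (hint.const_mul B).congr houter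
  have hsupp : ∫ r in Set.Ioi (0 : ℝ), F r = ∫ r in (0 : ℝ)..d, F r := by
    rw [intervalIntegral.integral_of_le hd.le]
    refine setIntegral_eq_of_subset_of_forall_sdiff_eq_zero measurableSet_Ioi
      Set.Ioc_subset_Ioi_self fun r hr => ?_
    have h : d < r := not_le.mp fun h => hr.2 ⟨hr.1, h⟩
    simp [hF, h.not_gt, (hcd.trans_lt h).not_ge]
  rw [hsupp, ← intervalIntegral.integral_add_adjacent_intervals hint₁ hint₂,
    ← intervalIntegral.integral_congr_ae (ae_of_all _ hinner),
    ← intervalIntegral.integral_congr_ae (ae_of_all _ houter),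
    intervalIntegral.integral_const_mul, intervalIntegral.integral_const_mul, hval,
    integral_rpow (Or.inl (by linarith))]
  simp [ha.ne']

/-- For `d > 0`, an integer `j ≥ 2` and `0 ≤ γ < 2`, the integral over `ℝ²` of
`ω_j(x) / ‖x‖^γ` equals `(d^{2-γ}/(2-γ)²) √(2π/log j) (1 - 1/j^{2-γ})`. -/
theorem stmt_8 (d : ℝ) (hd : 0 < d) (j : ℕ) (hj : 2 ≤ j) (γ : ℝ) (hγ0 : 0 ≤ γ) (hγ2 : γ < 2) :
    ∫ x : EuclideanSpace ℝ (Fin 2), moser d j x / ‖x‖ ^ γ =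
      d ^ (2 - γ) / (2 - γ) ^ 2 * Real.sqrt (2 * Real.pi / Real.log j) *
        (1 - 1 / (j : ℝ) ^ (2 - γ)) := by
  have hj1 : (1 : ℝ) < j := by exact_mod_cast hj
  have hj0 : (0 : ℝ) < j := zero_lt_one.trans hj1
  have hL : 0 < Real.log j := Real.log_pos hj1
  have ha : 0 < 2 - γ := sub_pos.mpr hγ2
  have hc : 0 < d / j := div_pos hd hj0
  have hcd : d / j ≤ d := div_le_self hd.le hj1.le
  have hpolar := integral_radial_plane fun r =>
    (if r ≤ d / j then Real.sqrt (Real.log j) / Real.sqrt (2 * Real.pi)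
      else if r < d then Real.log (d / r) / (Real.sqrt (2 * Real.pi) * Real.sqrt (Real.log j))
      else 0) / r ^ γ
  have hprofile := integral_rpow_mul_truncated_log
    (Real.sqrt (Real.log j) / Real.sqrt (2 * Real.pi))
    (1 / (Real.sqrt (2 * Real.pi) * Real.sqrt (Real.log j))) ha hc hcd
  simp only [moser]
  rw [hpolar, setIntegral_congr_fun measurableSet_Ioi (g := fun r : ℝ => r ^ (2 - γ - 1) *
    (if r ≤ d / j then Real.sqrt (Real.log j) / Real.sqrt (2 * Real.pi) else if r < d then
      1 / (Real.sqrt (2 * Real.pi) * Real.sqrt (Real.log j)) * Real.log (d / r) else 0)), hprofile,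
    Real.div_rpow hd.le hj0.le, div_div_cancel₀ hd.ne', Real.sqrt_div (by positivity)]
  · have hJ : 0 < (j : ℝ) ^ (2 - γ) := Real.rpow_pos_of_pos hj0 _
    have hs : 0 < Real.sqrt (Real.log j) := Real.sqrt_pos.mpr hL
    have ht : 0 < Real.sqrt (2 * Real.pi) := Real.sqrt_pos.mpr (by positivity)
    have hs2 : Real.log j = Real.sqrt (Real.log j) ^ 2 := (Real.sq_sqrt hL.le).symm
    have ht2 : 2 * Real.pi = Real.sqrt (2 * Real.pi) ^ 2 := (Real.sq_sqrt (by positivity)).symm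
    generalize Real.sqrt (Real.log j) = s at *
    generalize Real.sqrt (2 * Real.pi) = t at *
    generalize (j : ℝ) ^ (2 - γ) = J at *
    generalize 2 - γ = a at *
    rw [hs2, ht2]
    field_simp
    ring
  · intro r hr
    have hr0 : (0 : ℝ) < r := hr
    have hpow : r ^ (2 - γ - 1) = r / r ^ γ := by
      rw [show 2 - γ - 1 = 1 - γ by ring, Real.rpow_sub hr0, Real.rpow_one]
    simp only [hpow]
    split_ifs <;> ring
end

section
/- For every real d > 0, every integer j ≥ 2, and every γ with 0 ≤ γ < 2, the integral over ℝ² of ω_j(x)²/‖x‖^γ with respect to Lebesgue measure equals (2·d^{2−γ}/((2−γ)³·log j))·[1 − ((2−γ)·log j + 1)/j^{2−γ}], where ω_j is the Moser function. -/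
open MeasureTheory

/-- The profile of the Moser function: `moser d j x = moserProfile d j ‖x‖`. -/
noncomputable def moserProfile (d : ℝ) (j : ℕ) (r : ℝ) : ℝ :=
  if r ≤ d / j then Real.sqrt (Real.log j) / Real.sqrt (2 * Real.pi)
  else if r < d then Real.log (d / r) / (Real.sqrt (2 * Real.pi) * Real.sqrt (Real.log j))
  else 0

/-- Integration of a radial function on the Euclidean plane in polar coordinates. -/
lemma integral_euclideanPlane_radial (f : ℝ → ℝ) :
    ∫ x : EuclideanSpace ℝ (Fin 2), f ‖x‖ = 2 * Real.pi * ∫ r in Set.Ioi (0 : ℝ), r * f r := by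
  rw [integral_fun_norm_addHaar volume f]
  simp [Measure.real, EuclideanSpace.volume_ball_fin_two, Real.pi_pos.le, mul_assoc]

lemma hasDerivAt_rpow_mul_log_sq_primitive {d r a : ℝ} (hd : 0 < d) (hr : 0 < r) (ha : a ≠ 0) :
    HasDerivAt (fun r : ℝ ↦ r ^ a * (Real.log (d / r) ^ 2 / a + 2 * Real.log (d / r) / a ^ 2
      + 2 / a ^ 3)) (r ^ (a - 1) * Real.log (d / r) ^ 2) r := by
  have hlog : HasDerivAt (fun r : ℝ ↦ Real.log (d / r)) (-r⁻¹) r := by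
    have h := (Real.hasDerivAt_log hr.ne').const_sub (Real.log d)
    refine h.congr_of_eventuallyEq ?_
    filter_upwards [lt_mem_nhds hr] with s hs
    exact Real.log_div hd.ne' hs.ne'
  have hpow : HasDerivAt (fun r : ℝ ↦ r ^ a) (a * r ^ (a - 1)) r :=
    Real.hasDerivAt_rpow_const (Or.inl hr.ne')
  have h := hpow.mul ((((hlog.pow 2).div_const a).add
    ((hlog.const_mul 2).div_const (a ^ 2))).add_const (2 / a ^ 3))
  refine h.congr_deriv ?_
  have hra : r ^ a = r ^ (a - 1) * r := by
    rw [Real.rpow_sub_one hr.ne', div_mul_cancel₀ _ hr.ne']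
  simp only [Pi.pow_apply, Pi.add_apply, hra]
  field_simp
  ring

lemma continuousOn_rpow_mul_log_sq {d e a : ℝ} (hd : 0 < d) (he : 0 < e) (hed : e ≤ d) :
    ContinuousOn (fun r : ℝ ↦ r ^ (a - 1) * Real.log (d / r) ^ 2) (Set.uIcc e d) := by
  intro r hr
  rw [Set.uIcc_of_le hed] at hr
  have hr0 : 0 < r := he.trans_le hr.1
  refine ContinuousAt.continuousWithinAt ?_
  refine (Real.continuousAt_rpow_const _ _ (Or.inl hr0.ne')).mul (ContinuousAt.pow ?_ 2)
  exact (continuousAt_const.div continuousAt_id hr0.ne').log (div_pos hd hr0).ne'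

lemma integral_rpow_mul_log_sq {d e a : ℝ} (hd : 0 < d) (he : 0 < e) (hed : e ≤ d) (ha : a ≠ 0) :
    ∫ r in e..d, r ^ (a - 1) * Real.log (d / r) ^ 2 = 2 * d ^ a / a ^ 3 -
      e ^ a * (Real.log (d / e) ^ 2 / a + 2 * Real.log (d / e) / a ^ 2 + 2 / a ^ 3) := by
  rw [intervalIntegral.integral_eq_sub_of_hasDerivAt
    (fun r hr ↦ hasDerivAt_rpow_mul_log_sq_primitive hd
      (he.trans_le (Set.uIcc_of_le hed ▸ hr).1) ha)
    (continuousOn_rpow_mul_log_sq hd he hed).intervalIntegrable]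
  simp [div_self hd.ne']
  ring

/-- For `d > 0`, an integer `j ≥ 2` and `0 ≤ γ < 2`, the integral over `ℝ²` of
`ω_j(x)² / ‖x‖^γ` equals `(2 d^{2-γ}/((2-γ)³ log j)) [1 - ((2-γ) log j + 1)/j^{2-γ}]`. -/
theorem stmt_9 (d : ℝ) (hd : 0 < d) (j : ℕ) (hj : 2 ≤ j) (γ : ℝ) (hγ0 : 0 ≤ γ) (hγ2 : γ < 2) :
    ∫ x : EuclideanSpace ℝ (Fin 2), (moser d j x) ^ 2 / ‖x‖ ^ γ =
      2 * d ^ (2 - γ) / ((2 - γ) ^ 3 * Real.log j) *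
        (1 - ((2 - γ) * Real.log j + 1) / (j : ℝ) ^ (2 - γ)) := by
  have hj1 : (1 : ℝ) < j := by exact_mod_cast hj
  have hj0 : (0 : ℝ) < j := by linarith
  have hL : 0 < Real.log j := Real.log_pos hj1
  have he : 0 < d / j := by positivity
  have hed : d / j ≤ d := div_le_self hd.le hj1.le
  have hpi := Real.pi_pos
  obtain ⟨a, rfl⟩ : ∃ a, γ = 2 - a := ⟨2 - γ, by ring⟩
  have ha : 0 < a := by linarith
  rw [sub_sub_cancel]
  have hpow : ∀ r : ℝ, 0 < r → r / r ^ (2 - a) = r ^ (a - 1) := fun r hr ↦ by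
    rw [show a - 1 = 1 - (2 - a) by ring, Real.rpow_sub hr 1, Real.rpow_one]
  set G : ℝ → ℝ := fun r ↦ r * (moserProfile d j r ^ 2 / r ^ (2 - a)) with hG
  have hinner : Set.EqOn (fun r ↦ Real.log j / (2 * Real.pi) * r ^ (a - 1)) G
      (Set.uIoc 0 (d / j)) := by
    intro r hr
    rw [Set.uIoc_of_le he.le] at hr
    simp only [hG, moserProfile, if_pos hr.2, div_pow, Real.sq_sqrt hL.le,
      Real.sq_sqrt (by positivity : 0 ≤ 2 * Real.pi), ← hpow r hr.1]
    ring
  have houter : Set.EqOn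
      (fun r ↦ 1 / (2 * Real.pi * Real.log j) * (r ^ (a - 1) * Real.log (d / r) ^ 2)) G
      (Set.uIoc (d / j) d) := by
    intro r hr
    rw [Set.uIoc_of_le hed] at hr
    have hr0 : 0 < r := he.trans hr.1
    rcases hr.2.eq_or_lt with rfl | hrd
    · simp [hG, moserProfile, hr.1.not_ge, div_self hr0.ne']
    · simp only [hG, moserProfile, if_neg hr.1.not_ge, if_pos hrd, div_pow, mul_pow,
        Real.sq_sqrt hL.le, Real.sq_sqrt (by positivity : 0 ≤ 2 * Real.pi), ← hpow r hr0]
      ring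
  have hGinner : IntervalIntegrable G volume 0 (d / j) :=
    ((intervalIntegral.intervalIntegrable_rpow' (by linarith)).const_mul _).congr hinner
  have hGouter : IntervalIntegrable G volume (d / j) d :=
    ((continuousOn_rpow_mul_log_sq hd he hed).intervalIntegrable.const_mul _).congr houter
  have hsupp : ∫ r in Set.Ioi (0 : ℝ), G r = ∫ r in (0 : ℝ)..d, G r := by
    rw [intervalIntegral.integral_of_le hd.le]
    refine setIntegral_eq_of_subset_of_forall_sdiff_eq_zero measurableSet_Ioi
      Set.Ioc_subset_Ioi_self fun r hr ↦ ?_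
    have hdr : d < r := not_le.1 fun h ↦ hr.2 ⟨hr.1, h⟩
    simp [hG, moserProfile, (hed.trans_lt hdr).not_ge, hdr.not_gt]
  have hpolar := integral_euclideanPlane_radial fun r ↦ moserProfile d j r ^ 2 / r ^ (2 - a)
  change ∫ x : EuclideanSpace ℝ (Fin 2), moser d j x ^ 2 / ‖x‖ ^ (2 - a) =
    2 * Real.pi * ∫ r in Set.Ioi (0 : ℝ), G r at hpolar
  rw [hpolar, hsupp, ← intervalIntegral.integral_add_adjacent_intervals hGinner hGouter,
    ← intervalIntegral.integral_congr_uIoo (hinner.mono Set.Ioo_subset_Ioc_self),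
    ← intervalIntegral.integral_congr_uIoo (houter.mono Set.Ioo_subset_Ioc_self),
    intervalIntegral.integral_const_mul, intervalIntegral.integral_const_mul,
    integral_rpow_mul_log_sq hd he hed ha.ne', integral_rpow (Or.inl (by linarith)),
    div_div_cancel₀ hd.ne', sub_add_cancel, Real.zero_rpow ha.ne',
    Real.div_rpow hd.le hj0.le]
  have hja : (0 : ℝ) < (j : ℝ) ^ a := Real.rpow_pos_of_pos hj0 a
  field_simp
  ring
end

section
/- The limit as n → ∞ of n·∫_0^1 exp(−n·t·(1−t)) dt equals 2, where n ranges over the positive reals (equivalently over the natural numbers) and the integral is with respect to Lebesgue measure on [0,1]. -/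
open MeasureTheory Filter

lemma integral_exp_neg_mul_mul_one_sub (n : ℝ) :
    ∫ t in (0:ℝ)..1, Real.exp (-n * t * (1 - t)) =
      2 * ∫ t in (0:ℝ)..(1 / 2), Real.exp (-n * t * (1 - t)) := by
  have h_int (a b : ℝ) :
      IntervalIntegrable (fun t : ℝ => Real.exp (-n * t * (1 - t))) volume a b :=
    Continuous.intervalIntegrable (by fun_prop) a b
  have hsymm := intervalIntegral.integral_comp_sub_left (a := 0) (b := 1 / 2)
    (fun t : ℝ => Real.exp (-n * t * (1 - t))) 1
  rw [show (1 : ℝ) - 1 / 2 = 1 / 2 by norm_num, sub_zero] at hsymm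
  rw [← intervalIntegral.integral_add_adjacent_intervals (h_int 0 (1 / 2)) (h_int (1 / 2) 1),
    ← hsymm, two_mul]
  congr 2 with t
  ring_nf

lemma mul_integral_exp_neg_eq_integral_indicator {n : ℝ} (hn : 0 < n) :
    n * ∫ t in (0:ℝ)..(1 / 2), Real.exp (-n * t * (1 - t)) =
      ∫ u in Set.Ioi (0:ℝ),
        (Set.Iic (n / 2)).indicator (fun u => Real.exp (-u * (1 - u / n))) u := by
  have hscale := intervalIntegral.mul_integral_comp_mul_left (a := 0) (b := 1 / 2)
    (f := fun u : ℝ => Real.exp (-u * (1 - u / n))) n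
  rw [setIntegral_indicator measurableSet_Iic, Set.Ioi_inter_Iic,
    ← intervalIntegral.integral_of_le (by positivity)]
  convert hscale using 3
  · ext t
    field_simp
  · simp
  · ring

lemma tendsto_integral_indicator_exp_neg :
    Tendsto (fun n : ℝ => ∫ u in Set.Ioi (0:ℝ),
        (Set.Iic (n / 2)).indicator (fun u => Real.exp (-u * (1 - u / n))) u)
      atTop (nhds 1) := by
  suffices h : Tendsto (fun n : ℝ => ∫ u in Set.Ioi (0:ℝ),
      (Set.Iic (n / 2)).indicator (fun u => Real.exp (-u * (1 - u / n))) u)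
      atTop (nhds (∫ u in Set.Ioi (0:ℝ), Real.exp (-u))) by
    rwa [integral_exp_neg_Ioi_zero] at h
  refine tendsto_integral_filter_of_dominated_convergence
    (fun u => Real.exp (-(1 / 2) * u)) ?_ ?_ ?_ ?_
  · refine Eventually.of_forall fun n => ?_
    have hcont : Continuous fun u : ℝ => Real.exp (-u * (1 - u / n)) := by fun_prop
    exact (hcont.measurable.indicator measurableSet_Iic).aestronglyMeasurable
  · filter_upwards [eventually_gt_atTop 0] with n hn
    refine (ae_restrict_iff' measurableSet_Ioi).2 (Eventually.of_forall fun u hu => ?_)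
    rw [Set.mem_Ioi] at hu
    by_cases hle : u ∈ Set.Iic (n / 2)
    · rw [Set.indicator_of_mem hle, Real.norm_eq_abs, Real.abs_exp, Real.exp_le_exp]
      have hdiv : u / n ≤ 1 / 2 := by
        rw [div_le_iff₀ hn]
        linarith [Set.mem_Iic.1 hle]
      nlinarith
    · rw [Set.indicator_of_notMem hle, norm_zero]
      positivity
  · exact exp_neg_integrableOn_Ioi 0 (by norm_num)
  · refine Eventually.of_forall fun u => ?_
    have hlim : Tendsto (fun n : ℝ => Real.exp (-u * (1 - u / n))) atTop
        (nhds (Real.exp (-u))) := by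
      have hdiv : Tendsto (fun n : ℝ => u / n) atTop (nhds 0) := tendsto_id.const_div_atTop u
      simpa using ((hdiv.const_sub 1).const_mul (-u)).rexp
    refine hlim.congr' ?_
    filter_upwards [eventually_ge_atTop (2 * u)] with n hn
    rw [Set.indicator_of_mem]
    rw [Set.mem_Iic]
    linarith

/-- `n ∫_0^1 e^{-n t (1-t)} dt → 2` as the real parameter `n → ∞`. -/
theorem stmt_11 :
    Tendsto (fun n : ℝ => n * ∫ t in (0:ℝ)..1, Real.exp (-n * t * (1 - t)))
      atTop (nhds 2) := by
  have hlim := tendsto_integral_indicator_exp_neg.const_mul 2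
  rw [mul_one] at hlim
  refine hlim.congr' ?_
  filter_upwards [eventually_gt_atTop 0] with n hn
  rw [← mul_integral_exp_neg_eq_integral_indicator hn, integral_exp_neg_mul_mul_one_sub]
  ring
end

section
/- For every real c ≥ 0, liminf as n → ∞ of n·∫_0^1 exp(−n·t·(1−t) − c·t²) dt is at least 2·exp(−c), where the integral is with respect to Lebesgue measure on [0,1]. -/
open MeasureTheory Filter

lemma mul_integral_exp_neg_mul (k : ℝ) :
    k * ∫ t in (0:ℝ)..1, Real.exp (-(k * t)) = 1 - Real.exp (-k) := by
  rw [← intervalIntegral.integral_const_mul]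
  have h : ∀ t ∈ Set.uIcc (0:ℝ) 1,
      HasDerivAt (fun t => -Real.exp (-(k * t))) (k * Real.exp (-(k * t))) t := by
    intro t _
    have h1 : HasDerivAt (fun t => -(k * t)) (-(k * 1)) t :=
      ((hasDerivAt_id t).const_mul k).neg
    exact h1.exp.neg.congr_deriv (by ring)
  rw [intervalIntegral.integral_eq_sub_of_hasDerivAt h
    (Continuous.intervalIntegrable (by fun_prop) _ _)]
  simp
  ring

lemma integral_exp_neg_mul_one_sub (k : ℝ) :
    ∫ t in (0:ℝ)..1, Real.exp (-(k * (1 - t))) = ∫ t in (0:ℝ)..1, Real.exp (-(k * t)) := by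
  rw [intervalIntegral.integral_comp_sub_left (fun t => Real.exp (-(k * t))) 1]
  simp

lemma exp_neg_mul_one_sub_le {n c t : ℝ} (hn : 0 ≤ n) (hc : 0 ≤ c) (ht : t ∈ Set.Icc (0:ℝ) 1) :
    Real.exp (-n * t * (1 - t) - c * t ^ 2) ≤
      Real.exp (-(n / 2 * t)) + Real.exp (-(n / 2 * (1 - t))) := by
  obtain ⟨h0, h1⟩ := ht
  have hct : 0 ≤ c * t ^ 2 := by positivity
  rcases le_total t (1 / 2) with h | h
  · have : Real.exp (-n * t * (1 - t) - c * t ^ 2) ≤ Real.exp (-(n / 2 * t)) := by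
      apply Real.exp_le_exp.2
      nlinarith [mul_nonneg (mul_nonneg hn h0) (sub_nonneg.2 h)]
    linarith [Real.exp_pos (-(n / 2 * (1 - t)))]
  · have : Real.exp (-n * t * (1 - t) - c * t ^ 2) ≤ Real.exp (-(n / 2 * (1 - t))) := by
      apply Real.exp_le_exp.2
      nlinarith [mul_nonneg (mul_nonneg hn (sub_nonneg.2 h1)) (sub_nonneg.2 h)]
    linarith [Real.exp_pos (-(n / 2 * t))]

lemma le_exp_neg_mul_one_sub {n c t : ℝ} (hn : 0 ≤ n) (hc : 0 ≤ c) (ht : t ∈ Set.Icc (0:ℝ) 1) :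
    Real.exp (-c) *
        (Real.exp (-(n * t)) + Real.exp (-(n * (1 - t))) - Real.exp (-(n / 2))) ≤
      Real.exp (-n * t * (1 - t) - c * t ^ 2) := by
  obtain ⟨h0, h1⟩ := ht
  have hct : Real.exp (-c) * Real.exp (-(n * t * (1 - t))) ≤
      Real.exp (-n * t * (1 - t) - c * t ^ 2) := by
    rw [← Real.exp_add]
    apply Real.exp_le_exp.2
    nlinarith [mul_nonneg hc (show 0 ≤ 1 - t ^ 2 by nlinarith)]
  refine le_trans (mul_le_mul_of_nonneg_left ?_ (Real.exp_pos _).le) hct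
  have ha : Real.exp (-(n * t)) ≤ Real.exp (-(n * t * (1 - t))) := by
    apply Real.exp_le_exp.2
    nlinarith [mul_nonneg hn (mul_nonneg h0 h0)]
  have hb : Real.exp (-(n * (1 - t))) ≤ Real.exp (-(n * t * (1 - t))) := by
    apply Real.exp_le_exp.2
    nlinarith [mul_nonneg hn (mul_nonneg (sub_nonneg.2 h1) (sub_nonneg.2 h1))]
  rcases le_total t (1 / 2) with h | h
  · have : Real.exp (-(n * (1 - t))) ≤ Real.exp (-(n / 2)) := by
      apply Real.exp_le_exp.2
      nlinarith
    linarith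
  · have : Real.exp (-(n * t)) ≤ Real.exp (-(n / 2)) := by
      apply Real.exp_le_exp.2
      nlinarith
    linarith

lemma mul_integral_exp_le {n c : ℝ} (hn : 0 ≤ n) (hc : 0 ≤ c) :
    n * ∫ t in (0:ℝ)..1, Real.exp (-n * t * (1 - t) - c * t ^ 2) ≤ 4 := by
  have h : ∫ t in (0:ℝ)..1, Real.exp (-n * t * (1 - t) - c * t ^ 2) ≤
      ∫ t in (0:ℝ)..1, (Real.exp (-(n / 2 * t)) + Real.exp (-(n / 2 * (1 - t)))) :=
    intervalIntegral.integral_mono_on zero_le_one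
      (Continuous.intervalIntegrable (by fun_prop) _ _)
      (Continuous.intervalIntegrable (by fun_prop) _ _)
      fun t ht => exp_neg_mul_one_sub_le hn hc ht
  rw [intervalIntegral.integral_add (Continuous.intervalIntegrable (by fun_prop) _ _)
    (Continuous.intervalIntegrable (by fun_prop) _ _), integral_exp_neg_mul_one_sub] at h
  have h2 := mul_integral_exp_neg_mul (n / 2)
  have h3 := mul_le_mul_of_nonneg_left h hn
  linarith [Real.exp_pos (-(n / 2))]

lemma le_mul_integral_exp {n c : ℝ} (hn : 0 ≤ n) (hc : 0 ≤ c) :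
    Real.exp (-c) * (2 * (1 - Real.exp (-n)) - n * Real.exp (-(n / 2))) ≤
      n * ∫ t in (0:ℝ)..1, Real.exp (-n * t * (1 - t) - c * t ^ 2) := by
  have h : ∫ t in (0:ℝ)..1, Real.exp (-c) *
        (Real.exp (-(n * t)) + Real.exp (-(n * (1 - t))) - Real.exp (-(n / 2))) ≤
      ∫ t in (0:ℝ)..1, Real.exp (-n * t * (1 - t) - c * t ^ 2) :=
    intervalIntegral.integral_mono_on zero_le_one
      (Continuous.intervalIntegrable (by fun_prop) _ _)
      (Continuous.intervalIntegrable (by fun_prop) _ _)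
      fun t ht => le_exp_neg_mul_one_sub hn hc ht
  rw [intervalIntegral.integral_const_mul,
    intervalIntegral.integral_sub (Continuous.intervalIntegrable (by fun_prop) _ _)
      (Continuous.intervalIntegrable (by fun_prop) _ _),
    intervalIntegral.integral_add (Continuous.intervalIntegrable (by fun_prop) _ _)
      (Continuous.intervalIntegrable (by fun_prop) _ _), integral_exp_neg_mul_one_sub,
    intervalIntegral.integral_const] at h
  refine le_of_eq_of_le ?_ (mul_le_mul_of_nonneg_left h hn)
  rw [← mul_integral_exp_neg_mul n]
  simp only [sub_zero, one_smul]
  ring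

lemma tendsto_exp_lower_bound (c : ℝ) :
    Tendsto (fun n : ℝ => Real.exp (-c) * (2 * (1 - Real.exp (-n)) - n * Real.exp (-(n / 2))))
      atTop (nhds (2 * Real.exp (-c))) := by
  have h1 : Tendsto (fun n : ℝ => Real.exp (-n)) atTop (nhds 0) :=
    Real.tendsto_exp_neg_atTop_nhds_zero
  have h2 : Tendsto (fun n : ℝ => n * Real.exp (-(n / 2))) atTop (nhds 0) := by
    have := ((Real.tendsto_pow_mul_exp_neg_atTop_nhds_zero 1).comp
      (tendsto_id.atTop_div_const (r := (2:ℝ)) two_pos)).const_mul 2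
    simp only [mul_zero] at this
    refine this.congr fun n => ?_
    simp only [Function.comp_apply, id, pow_one]
    ring
  have h3 := (((h1.const_sub 1).const_mul 2).sub h2).const_mul (Real.exp (-c))
  convert h3 using 2
  ring

/-- For `c ≥ 0`, `liminf_{n → ∞} n ∫_0^1 e^{-n t (1-t) - c t²} dt ≥ 2 e^{-c}`. -/
theorem stmt_12 (c : ℝ) (hc : 0 ≤ c) :
    2 * Real.exp (-c) ≤
      Filter.liminf
        (fun n : ℝ => n * ∫ t in (0:ℝ)..1, Real.exp (-n * t * (1 - t) - c * t ^ 2))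
        Filter.atTop := by
  have hlim := tendsto_exp_lower_bound c
  rw [← hlim.liminf_eq]
  refine liminf_le_liminf ?_ hlim.isBoundedUnder_ge ?_
  · filter_upwards [eventually_ge_atTop 0] with n hn using le_mul_integral_exp hn hc
  · refine IsBoundedUnder.isCoboundedUnder_ge (isBoundedUnder_of_eventually_le (a := 4) ?_)
    filter_upwards [eventually_ge_atTop 0] with n hn using mul_integral_exp_le hn hc
end

section
/- Let 0 ≤ γ < 2, let (s_n) be a sequence in (0,1) with s_n → 0, and let (a_n) be a sequence of nonnegative reals with a_n → 0 such that for some constant K one has a_n·(log s_n)² ≤ K for all n. Then ∫_{s_n}^1 s^{1−γ}·exp(a_n·(log s)²) ds → 1/(2−γ) as n → ∞. -/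
open MeasureTheory Filter

/-- Let `0 ≤ γ < 2`, let `s_n ∈ (0,1)` with `s_n → 0`, and let `a_n ≥ 0` with `a_n → 0`
and `a_n (log s_n)² ≤ K` for all `n`. Then
`∫_{s_n}^1 s^{1-γ} e^{a_n (log s)²} ds → 1/(2-γ)`. -/
theorem stmt_14 (γ : ℝ) (hγ0 : 0 ≤ γ) (hγ2 : γ < 2) (s a : ℕ → ℝ)
    (hs : ∀ n, s n ∈ Set.Ioo (0:ℝ) 1) (hs0 : Tendsto s atTop (nhds 0))
    (ha0 : ∀ n, 0 ≤ a n) (halim : Tendsto a atTop (nhds 0))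
    (K : ℝ) (hK : ∀ n, a n * (Real.log (s n)) ^ 2 ≤ K) :
    Tendsto (fun n => ∫ x in (s n)..1, x ^ (1 - γ) * Real.exp (a n * (Real.log x) ^ 2))
      atTop (nhds (1 / (2 - γ))) := by
  have hint : IntervalIntegrable (fun x : ℝ => x ^ (1 - γ)) volume 0 1 :=
    intervalIntegral.intervalIntegrable_rpow' (by linarith)
  have hval : ∫ x in (0:ℝ)..1, x ^ (1 - γ) = 1 / (2 - γ) := by
    have hexp : 1 - γ + 1 = 2 - γ := by ring
    rw [integral_rpow (Or.inl (by linarith)), hexp, Real.one_rpow,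
      Real.zero_rpow (by linarith), sub_zero]
  have hrew : ∀ n, ∫ x in (s n)..1, x ^ (1 - γ) * Real.exp (a n * (Real.log x) ^ 2) =
      ∫ x in (0:ℝ)..1, (Set.Ioc (s n) 1).indicator
        (fun x => x ^ (1 - γ) * Real.exp (a n * (Real.log x) ^ 2)) x := by
    intro n
    rw [intervalIntegral.integral_of_le (hs n).2.le, intervalIntegral.integral_of_le zero_le_one,
      setIntegral_indicator measurableSet_Ioc,
      Set.inter_eq_self_of_subset_right (Set.Ioc_subset_Ioc_left (hs n).1.le)]
  simp_rw [hrew]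
  rw [← hval]
  refine intervalIntegral.tendsto_integral_filter_of_dominated_convergence
    (fun x => x ^ (1 - γ) * Real.exp K) (Eventually.of_forall fun n => ?_)
    (Eventually.of_forall fun n => Eventually.of_forall fun x hx => ?_)
    (hint.mul_const _) (Eventually.of_forall fun x hx => ?_)
  · refine Measurable.aestronglyMeasurable (Measurable.indicator ?_ measurableSet_Ioc)
    fun_prop
  · rw [Set.uIoc_of_le zero_le_one] at hx
    have hpow : 0 ≤ x ^ (1 - γ) := Real.rpow_nonneg hx.1.le _
    by_cases hxs : x ∈ Set.Ioc (s n) 1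
    · rw [Set.indicator_of_mem hxs, Real.norm_of_nonneg (by positivity)]
      have hlog : Real.log (s n) ≤ Real.log x := Real.log_le_log (hs n).1 hxs.1.le
      have hlog0 : Real.log x ≤ 0 := Real.log_nonpos hx.1.le hx.2
      have hsq : (Real.log x) ^ 2 ≤ (Real.log (s n)) ^ 2 := by nlinarith
      gcongr
      exact (mul_le_mul_of_nonneg_left hsq (ha0 n)).trans (hK n)
    · rw [Set.indicator_of_notMem hxs, norm_zero]
      positivity
  · rw [Set.uIoc_of_le zero_le_one] at hx
    have hlim : Tendsto (fun n => x ^ (1 - γ) * Real.exp (a n * (Real.log x) ^ 2)) atTop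
        (nhds (x ^ (1 - γ))) := by
      simpa using ((halim.mul_const ((Real.log x) ^ 2)).rexp).const_mul (x ^ (1 - γ))
    refine hlim.congr' ?_
    filter_upwards [hs0.eventually_lt_const hx.1] with n hn
    have hmem : x ∈ Set.Ioc (s n) 1 := ⟨hn, hx.2⟩
    rw [Set.indicator_of_mem hmem]
end
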